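/- arXiv:1310.2658 — 15 statements merged into one kernel-verified Lean document; each statement's English description precedes it below -/
import Mathlib

section
/- Without VSL control (speed limit u = v_f) and with constant demand d⁻ > C, the link queue system has a unique equilibrium, which is congested: a density k* ∈ [0, k_j] satisfies F(v_f, k*) = G(k*) if and only if k* = k2 = k_j − (1−Δ)C/w. The corresponding equilibrium flow is G(k2) = (1−Δ)C. -/
/-- In-flux function of the link queue model:
`F(u,k) = min{d⁻, u*w*k_j/(u+w), w*(k_j−k)}`. -/
noncomputable def influx (dm w kj u k : ℝ) : ℝ :=
  min dm (min (u * w * kj / (u + w)) (w * (kj - k)))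

/-- Out-flux (discharging flow-rate) with capacity drop:
`G(k) = v_f*k` if `k ≤ k1 = C/v_f`, and `(1−Δ)*C` otherwise. -/
noncomputable def outflux (vf C Δ k : ℝ) : ℝ :=
  if k ≤ C / vf then vf * k else (1 - Δ) * C

/-- A capacity below the peak of the triangular fundamental diagram puts the critical density
`C / vf` strictly below the density `kj - C / w` on the congested branch. -/
theorem critical_density_lt_congested_density {vf w kj C : ℝ} (hvf : 0 < vf) (hw : 0 < w)
    (hC : C < vf * w * kj / (vf + w)) : C / vf < kj - C / w := by
  rw [lt_div_iff₀ (add_pos hvf hw)] at hC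
  rw [lt_sub_iff_add_lt, div_add_div _ _ hvf.ne' hw.ne', div_lt_iff₀ (mul_pos hvf hw)]
  linarith

/-- Without VSL control (`u = v_f`) and with constant demand `d⁻ > C`, the unique
equilibrium in `[0, k_j]` is the congested one `k2 = k_j − (1−Δ)C/w`, whose
equilibrium flow is `(1−Δ)C`. -/
theorem no_control_high_demand_unique_congested_equilibrium
    (vf w kj C Δ dm : ℝ)
    (hvf : 0 < vf) (hw : 0 < w) (hkj : 0 < kj)
    (hC0 : 0 < C) (hCub : C < vf * w * kj / (vf + w))
    (hΔ0 : 0 < Δ) (hΔ1 : Δ < 1)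
    (hdm : C < dm) :
    (∀ k : ℝ, 0 ≤ k → k ≤ kj →
      (influx dm w kj vf k = outflux vf C Δ k ↔ k = kj - (1 - Δ) * C / w)) ∧
    outflux vf C Δ (kj - (1 - Δ) * C / w) = (1 - Δ) * C := by
  have hgap := critical_density_lt_congested_density hvf hw hCub
  have hdrop : (1 - Δ) * C < C := by nlinarith
  have hk2 : C / vf < kj - (1 - Δ) * C / w :=
    hgap.trans (sub_lt_sub_left (div_lt_div_of_pos_right hdrop hw) kj)
  refine ⟨fun k _ _ => ?_, if_neg hk2.not_ge⟩
  unfold influx outflux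
  split_ifs with hk
  · have hout : vf * k ≤ C := by rwa [le_div_iff₀' hvf] at hk
    have hsupply : C < w * (kj - k) := by
      rw [← div_lt_iff₀' hw]
      linarith
    have hin := lt_min hdm (lt_min hCub hsupply)
    exact iff_of_false (hout.trans_lt hin).ne' (hk.trans_lt hk2).ne
  · have hsol : w * (kj - k) = (1 - Δ) * C ↔ k = kj - (1 - Δ) * C / w := by
      rw [mul_comm, ← eq_div_iff hw.ne', sub_eq_iff_eq_add', eq_sub_iff_add_eq, eq_comm]
    rw [← hsol]
    constructor
    · intro h
      rcases min_choice dm (min (vf * w * kj / (vf + w)) (w * (kj - k))) with h₁ | h₁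
      · linarith
      · rcases min_choice (vf * w * kj / (vf + w)) (w * (kj - k)) with h₂ | h₂ <;> linarith
    · intro h
      rw [h, min_eq_right (hdrop.trans hCub).le, min_eq_right (hdrop.trans hdm).le]
end

section
/- Without VSL control (speed limit u = v_f) and with constant demand satisfying (1−Δ)C < d⁻ ≤ C, the link queue system has exactly two equilibria: the uncongested state k* = d⁻/v_f (with equilibrium flow d⁻) and the congested state k* = k2 = k_j − (1−Δ)C/w (with equilibrium flow (1−Δ)C). That is, k* ∈ [0, k_j] satisfies F(v_f, k*) = G(k*) if and only if k* = d⁻/v_f or k* = k2. -/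
/-- Without VSL control (`u = v_f`) and with `(1−Δ)C < d⁻ ≤ C`, there are exactly two
equilibria in `[0, k_j]`: the uncongested `d⁻/v_f` (flow `d⁻`) and the congested
`k2 = k_j − (1−Δ)C/w` (flow `(1−Δ)C`). -/
theorem no_control_medium_demand_two_equilibria
    (vf w kj C Δ dm : ℝ)
    (hvf : 0 < vf) (hw : 0 < w) (hkj : 0 < kj)
    (hC0 : 0 < C) (hCub : C < vf * w * kj / (vf + w))
    (hΔ0 : 0 < Δ) (hΔ1 : Δ < 1)
    (hdm1 : (1 - Δ) * C < dm) (hdm2 : dm ≤ C) :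
    (∀ k : ℝ, 0 ≤ k → k ≤ kj →
      (influx dm w kj vf k = outflux vf C Δ k ↔
        k = dm / vf ∨ k = kj - (1 - Δ) * C / w)) ∧
    outflux vf C Δ (dm / vf) = dm ∧
    outflux vf C Δ (kj - (1 - Δ) * C / w) = (1 - Δ) * C := by
  have hcap : C * (vf + w) < vf * w * kj := (lt_div_iff₀ (add_pos hvf hw)).1 hCub
  have hdrop : (1 - Δ) * C < C := by nlinarith
  have hfree_le : dm / vf ≤ C / vf := by gcongr
  have hcong : C / vf < kj - (1 - Δ) * C / w := by
    have h : C / vf + C / w < kj := by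
      rw [div_add_div _ _ hvf.ne' hw.ne', div_lt_iff₀ (mul_pos hvf hw)]
      linarith
    have h' : (1 - Δ) * C / w < C / w := by gcongr
    linarith
  refine ⟨fun k _ _ => ?_, ?_, ?_⟩
  · unfold influx outflux
    by_cases hk : k ≤ C / vf
    · have hkC : k * vf ≤ C := (le_div_iff₀ hvf).1 hk
      have hsupply : C < w * (kj - k) := by
        have : vf * C < vf * (w * (kj - k)) := by nlinarith
        exact lt_of_mul_lt_mul_left this hvf.le
      rw [if_pos hk, min_eq_left (hdm2.trans (le_min hCub.le hsupply.le)),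
        or_iff_left (hk.trans_lt hcong).ne, eq_div_iff hvf.ne', mul_comm vf k, eq_comm]
    · have hne : k ≠ dm / vf := fun h => hk (h ▸ hfree_le)
      rw [if_neg hk, or_iff_right hne]
      have hiff : k = kj - (1 - Δ) * C / w ↔ w * (kj - k) = (1 - Δ) * C := by
        rw [eq_sub_iff_add_eq, ← eq_sub_iff_add_eq', div_eq_iff hw.ne', mul_comm w, eq_comm]
      rw [hiff]
      constructor
      · intro h
        rcases min_choice dm (min (vf * w * kj / (vf + w)) (w * (kj - k))) with h₁ | h₁
        · linarith
        · rcases min_choice (vf * w * kj / (vf + w)) (w * (kj - k)) with h₂ | h₂ <;> linarith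
      · intro h
        rw [h, min_eq_right (hdrop.trans hCub).le, min_eq_right hdm1.le]
  · rw [outflux, if_pos hfree_le, mul_div_cancel₀ _ hvf.ne']
  · rw [outflux, if_neg hcong.not_ge]
end

section
/- Without VSL control (speed limit u = v_f) and with constant demand d⁻ < (1−Δ)C, the link queue system has a unique equilibrium, which is uncongested: a density k* ∈ [0, k_j] satisfies F(v_f, k*) = G(k*) if and only if k* = d⁻/v_f, and the equilibrium flow is d⁻. -/
/-- At uncongested densities the in-flux equals any demand below the downstream capacity. -/
theorem influx_eq_demand {vf w kj C dm k : ℝ} (hvf : 0 < vf) (hw : 0 < w)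
    (hCub : C < vf * w * kj / (vf + w)) (hdm : dm < C) (hk : vf * k ≤ C) :
    influx dm w kj vf k = dm := by
  unfold influx
  refine min_eq_left (le_min (hdm.trans hCub).le ?_)
  rw [lt_div_iff₀ (by positivity)] at hCub
  refine hdm.le.trans (le_of_mul_le_mul_left ?_ hvf)
  nlinarith [mul_le_mul_of_nonneg_left hk hw.le]

/-- Without VSL control (`u = v_f`) and with `d⁻ < (1−Δ)C`, the unique equilibrium
in `[0, k_j]` is the uncongested `d⁻/v_f`, with equilibrium flow `d⁻`. -/
theorem no_control_low_demand_unique_uncongested_equilibrium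
    (vf w kj C Δ dm : ℝ)
    (hvf : 0 < vf) (hw : 0 < w) (hkj : 0 < kj)
    (hC0 : 0 < C) (hCub : C < vf * w * kj / (vf + w))
    (hΔ0 : 0 < Δ) (hΔ1 : Δ < 1)
    (hdm0 : 0 < dm) (hdm : dm < (1 - Δ) * C) :
    (∀ k : ℝ, 0 ≤ k → k ≤ kj →
      (influx dm w kj vf k = outflux vf C Δ k ↔ k = dm / vf)) ∧
    outflux vf C Δ (dm / vf) = dm := by
  have hdmC : dm < C := hdm.trans (by nlinarith)
  have hle : dm / vf ≤ C / vf := by gcongr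
  refine ⟨fun k _ _ => ?_, ?_⟩
  · unfold outflux
    split_ifs with h
    · rw [influx_eq_demand hvf hw hCub hdmC ((le_div_iff₀' hvf).mp h), eq_div_iff hvf.ne',
        mul_comm k, eq_comm]
    · refine iff_of_false (fun heq => ?_) (fun heq => h (heq ▸ hle))
      exact hdm.not_ge (heq ▸ min_le_left _ _)
  · rw [outflux, if_pos hle, mul_div_cancel₀ _ hvf.ne']
end

section
/- If the demand satisfies d⁻ > (1−Δ)C and a constant speed limit u with 0 < u < v2 is applied, then the link queue system has a unique equilibrium, which is uncongested: k* ∈ [0, k_j] satisfies F(u, k*) = G(k*) if and only if k* = u*w*k_j/((u+w)*v_f); moreover k* < (1−Δ)C/v_f and the equilibrium flow is u*w*k_j/(u+w) < (1−Δ)C. -/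
/-- With demand `d⁻ > (1−Δ)C` and a constant speed limit `0 < u < v2`, the unique
equilibrium in `[0, k_j]` is the uncongested `k* = u*w*k_j/((u+w)*v_f)`; moreover
`k* < (1−Δ)C/v_f` and the equilibrium flow is `u*w*k_j/(u+w) < (1−Δ)C`. -/
theorem low_speed_limit_unique_uncongested_equilibrium
    (vf w kj C Δ dm u : ℝ)
    (hvf : 0 < vf) (hw : 0 < w) (hkj : 0 < kj)
    (hC0 : 0 < C) (hCub : C < vf * w * kj / (vf + w))
    (hΔ0 : 0 < Δ) (hΔ1 : Δ < 1)
    (hdm : (1 - Δ) * C < dm)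
    (hu0 : 0 < u) (hu2 : u < (1 - Δ) * C * w / (kj * w - (1 - Δ) * C)) :
    (∀ k : ℝ, 0 ≤ k → k ≤ kj →
      (influx dm w kj u k = outflux vf C Δ k ↔ k = u * w * kj / ((u + w) * vf))) ∧
    u * w * kj / ((u + w) * vf) < (1 - Δ) * C / vf ∧
    outflux vf C Δ (u * w * kj / ((u + w) * vf)) = u * w * kj / (u + w) ∧
    u * w * kj / (u + w) < (1 - Δ) * C := by
  have hDC : (1 - Δ) * C < C := by nlinarith
  have hC : C * (vf + w) < vf * w * kj := (lt_div_iff₀ (by positivity)).1 hCub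
  have hCkj : C < kj * w := by
    have : vf * C < vf * (kj * w) := by nlinarith [mul_pos hC0 hw]
    exact lt_of_mul_lt_mul_left this hvf.le
  have hu : u * (kj * w - (1 - Δ) * C) < (1 - Δ) * C * w :=
    (lt_div_iff₀ (by linarith)).1 hu2
  have hQ : u * w * kj / (u + w) < (1 - Δ) * C := by
    rw [div_lt_iff₀ (by positivity)]
    linarith
  rw [← div_div]
  unfold influx outflux
  generalize u * w * kj / (u + w) = Q at hQ ⊢
  generalize (1 - Δ) * C = D at hDC hdm hQ ⊢
  have hle : Q / vf ≤ C / vf := by gcongr; linarith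
  refine ⟨fun k _ _ => ?_, by gcongr, ?_, hQ⟩
  · rw [eq_div_iff hvf.ne']
    by_cases hk : k ≤ C / vf
    · have hkC : k * vf ≤ C := (le_div_iff₀ hvf).1 hk
      have hcong : C < w * (kj - k) := by
        have : vf * C < vf * (w * (kj - k)) := by nlinarith
        exact lt_of_mul_lt_mul_left this hvf.le
      rw [if_pos hk, min_eq_left (by linarith : Q ≤ w * (kj - k)),
        min_eq_right (by linarith : Q ≤ dm), mul_comm vf k]
      exact eq_comm
    · rw [if_neg hk]
      constructor
      · intro h
        have : min dm (min Q (w * (kj - k))) ≤ Q :=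
          (min_le_right _ _).trans (min_le_left _ _)
        linarith
      · intro h
        exact absurd (((eq_div_iff hvf.ne').2 h).trans_le hle) hk
  · rw [if_pos hle, mul_div_cancel₀ _ hvf.ne']
end

section
/- If the demand satisfies d⁻ > C and a constant speed limit u with v2 < u ≤ v1 is applied, then the link queue system has exactly two equilibria: the uncongested state k* = u*w*k_j/((u+w)*v_f) ≤ k1 with equilibrium flow u*w*k_j/(u+w), and the congested state k* = k2 = k_j − (1−Δ)C/w with equilibrium flow (1−Δ)C. That is, k* ∈ [0, k_j] satisfies F(u, k*) = G(k*) if and only if k* = u*w*k_j/((u+w)*v_f) or k* = k2. -/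
/-- With demand `d⁻ > C` and a constant speed limit `u` with `v2 < u ≤ v1`, there
are exactly two equilibria in `[0, k_j]`: the uncongested `u*w*k_j/((u+w)*v_f) ≤ k1`
with flow `u*w*k_j/(u+w)`, and the congested `k2 = k_j − (1−Δ)C/w` with flow
`(1−Δ)C`. -/
theorem medium_speed_limit_high_demand_two_equilibria
    (vf w kj C Δ dm u : ℝ)
    (hvf : 0 < vf) (hw : 0 < w) (hkj : 0 < kj)
    (hC0 : 0 < C) (hCub : C < vf * w * kj / (vf + w))
    (hΔ0 : 0 < Δ) (hΔ1 : Δ < 1)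
    (hdm : C < dm)
    (hu1 : (1 - Δ) * C * w / (kj * w - (1 - Δ) * C) < u)
    (hu2 : u ≤ C * w / (kj * w - C)) :
    (∀ k : ℝ, 0 ≤ k → k ≤ kj →
      (influx dm w kj u k = outflux vf C Δ k ↔
        k = u * w * kj / ((u + w) * vf) ∨ k = kj - (1 - Δ) * C / w)) ∧
    u * w * kj / ((u + w) * vf) ≤ C / vf ∧
    outflux vf C Δ (u * w * kj / ((u + w) * vf)) = u * w * kj / (u + w) ∧
    outflux vf C Δ (kj - (1 - Δ) * C / w) = (1 - Δ) * C := by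
  have hD0 : 0 < (1 - Δ) * C := mul_pos (by linarith) hC0
  have hDC : (1 - Δ) * C < C := by nlinarith
  rw [lt_div_iff₀ (by positivity)] at hCub
  have hCw : C < kj * w := by nlinarith
  rw [div_lt_iff₀ (by linarith)] at hu1
  rw [le_div_iff₀ (by linarith)] at hu2
  have hu0 : 0 < u :=
    pos_of_mul_pos_left ((mul_pos hD0 hw).trans hu1) (by linarith)
  have hqC : u * w * kj / (u + w) ≤ C := by
    rw [div_le_iff₀ (by positivity)]
    linarith
  have hDq : (1 - Δ) * C < u * w * kj / (u + w) := by
    rw [lt_div_iff₀ (by positivity)]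
    linarith
  have hk1 : C < w * (kj - C / vf) := by
    have h : w * (kj - C / vf) = (w * kj * vf - w * C) / vf := by
      field_simp
    rw [h, lt_div_iff₀ hvf]
    linarith
  rw [← div_div]
  simp only [influx, outflux]
  generalize u * w * kj / (u + w) = q at hqC hDq ⊢
  generalize (1 - Δ) * C = D at hD0 hDC hDq ⊢
  have hk2 : C / vf < kj - D / w := by
    have h : D / w < kj - C / vf := by
      rw [div_lt_iff₀ hw]
      linarith
    linarith
  have hq1 : q / vf ≤ C / vf := by gcongr
  refine ⟨fun k _ _ => ?_, hq1, ?_, ?_⟩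
  · rw [min_eq_right ((min_le_left _ _).trans (hqC.trans hdm.le))]
    split_ifs with hk
    · have hwk : w * (kj - C / vf) ≤ w * (kj - k) := by gcongr
      rw [min_eq_left (by linarith), or_iff_left (by linarith), eq_div_iff hvf.ne',
        mul_comm k, eq_comm]
    · rw [or_iff_right (by rintro rfl; exact hk hq1)]
      have hiff : k = kj - D / w ↔ w * (kj - k) = D := by
        rw [eq_sub_iff_add_eq, ← eq_sub_iff_add_eq', div_eq_iff hw.ne', mul_comm w, eq_comm]
      rw [hiff]
      constructor
      · intro h
        rcases min_choice q (w * (kj - k)) with h' | h' <;> linarith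
      · intro h
        rw [h, min_eq_right hDq.le]
  · rw [if_pos hq1, mul_div_cancel₀ _ hvf.ne']
  · rw [if_neg hk2.not_ge]
end

section
/- If the demand satisfies (1−Δ)C < d⁻ ≤ C and a constant speed limit u ∈ (0, v_f] with u*w*k_j/(u+w) ≥ d⁻ is applied, then the link queue system has exactly two equilibria: the uncongested state k* = d⁻/v_f with equilibrium flow d⁻, and the congested state k* = k2 = k_j − (1−Δ)C/w with equilibrium flow (1−Δ)C. That is, k* ∈ [0, k_j] satisfies F(u, k*) = G(k*) if and only if k* = d⁻/v_f or k* = k2. -/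
/-- With demand `(1−Δ)C < d⁻ ≤ C` and a constant speed limit `u ∈ (0, v_f]`
satisfying `u*w*k_j/(u+w) ≥ d⁻`, there are exactly two equilibria in `[0, k_j]`:
the uncongested `d⁻/v_f` with flow `d⁻`, and the congested `k2` with flow
`(1−Δ)C`. -/
theorem medium_demand_sufficient_speed_limit_two_equilibria
    (vf w kj C Δ dm u : ℝ)
    (hvf : 0 < vf) (hw : 0 < w) (hkj : 0 < kj)
    (hC0 : 0 < C) (hCub : C < vf * w * kj / (vf + w))
    (hΔ0 : 0 < Δ) (hΔ1 : Δ < 1)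
    (hdm1 : (1 - Δ) * C < dm) (hdm2 : dm ≤ C)
    (hu0 : 0 < u) (hu1 : u ≤ vf) (hsup : dm ≤ u * w * kj / (u + w)) :
    (∀ k : ℝ, 0 ≤ k → k ≤ kj →
      (influx dm w kj u k = outflux vf C Δ k ↔
        k = dm / vf ∨ k = kj - (1 - Δ) * C / w)) ∧
    outflux vf C Δ (dm / vf) = dm ∧
    outflux vf C Δ (kj - (1 - Δ) * C / w) = (1 - Δ) * C := by
  have hcrit : C < w * (kj - C / vf) := by
    rw [lt_div_iff₀ (by positivity)] at hCub
    have h : w * (kj - C / vf) = (vf * w * kj - w * C) / vf := by field_simp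
    rw [h, lt_div_iff₀ hvf]
    linarith
  have hdrop : (1 - Δ) * C < C := by linarith
  have hk2 : w * (kj - (kj - (1 - Δ) * C / w)) = (1 - Δ) * C := by
    field_simp
    ring
  have hk2_gt : C / vf < kj - (1 - Δ) * C / w := by
    by_contra! h
    have := mul_le_mul_of_nonneg_left h hw.le
    linarith
  have hfree : dm / vf ≤ C / vf := by gcongr
  have hinflux (k : ℝ) : influx dm w kj u k = min dm (w * (kj - k)) := by
    rw [influx, ← min_assoc, min_eq_left hsup]
  refine ⟨fun k _ _ => ?_, ?_, ?_⟩
  · rw [hinflux, outflux]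
    split_ifs with hk
    · have hdm : dm ≤ w * (kj - k) := by
        have := mul_le_mul_of_nonneg_left hk hw.le
        linarith
      rw [min_eq_left hdm, or_iff_left (by linarith), eq_div_iff hvf.ne', mul_comm k]
      exact eq_comm
    · rw [or_iff_right (by linarith)]
      constructor
      · intro h
        have hflow : w * (kj - k) = (1 - Δ) * C := by
          rcases min_choice dm (w * (kj - k)) with h' | h' <;> linarith
        exact mul_left_cancel₀ hw.ne' (by linarith)
      · rintro rfl
        rw [hk2, min_eq_right hdm1.le]
  · rw [outflux, if_pos hfree, mul_div_cancel₀ _ hvf.ne']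
  · rw [outflux, if_neg hk2_gt.not_ge]
end

section
/- With demand d⁻ ≥ C and the constant optimal speed limit u = v1 = C*w/(k_j*w − C), if k : [0,∞) → ℝ is differentiable, satisfies l0*k'(t) = F(v1, k(t)) − G(k(t)) for all t ≥ 0, and k(0) = k0 ≤ k1, then k(t) = k1 − (k1 − k0)*exp(−v_f*t/l0) for all t ≥ 0. In particular k(t) converges exponentially to k1 and the discharging flow-rate G(k(t)) converges to the capacity C. -/
/-- At the optimal speed limit `v1 = C*w/(k_j*w − C)` the in-flux equals the capacity `C` as long
as the link supply `w*(k_j−k)` and the demand are at least `C`. -/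
theorem influx_optimal_speed_limit {w kj C dm k : ℝ} (hw : 0 < w) (hkj : 0 < kj)
    (hC : C < kj * w) (hdm : C ≤ dm) (hk : C ≤ w * (kj - k)) :
    influx dm w kj (C * w / (kj * w - C)) k = C := by
  have hpos : kj * w - C ≠ 0 := (sub_pos.2 hC).ne'
  have hpos' : w * kj - C ≠ 0 := by rwa [mul_comm]
  have hsum : C * w / (kj * w - C) + w = kj * w ^ 2 / (kj * w - C) := by
    field_simp
    ring
  have hlimit : C * w / (kj * w - C) * w * kj / (C * w / (kj * w - C) + w) = C := by
    rw [hsum]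
    field_simp
  rw [influx, hlimit, min_eq_left hk, min_eq_right hdm]

/-- A differentiable function whose derivative vanishes whenever it takes the value `a` and tends
to a nonzero limit along times just after leaving `(-∞, a]` cannot leave `(-∞, a]`. -/
theorem le_of_deriv_jump {f : ℝ → ℝ} {a c : ℝ} (hf : Differentiable ℝ f) (hc : c ≠ 0)
    (h0 : f 0 ≤ a) (hzero : ∀ t, 0 ≤ t → f t = a → deriv f t = 0)
    (hjump : ∀ s, 0 ≤ s → f s = a → ∀ᶠ t in nhds s, 0 ≤ t → a < f t → deriv f t = c)
    {T : ℝ} (hT : 0 ≤ T) : f T ≤ a := by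
  by_contra! hlt
  have hcompact : IsCompact (Set.Icc 0 T ∩ f ⁻¹' Set.Iic a) :=
    isCompact_Icc.inter_right (isClosed_Iic.preimage hf.continuous)
  obtain ⟨s, ⟨⟨hs0, hsT⟩, hsa⟩, hmax⟩ :=
    hcompact.exists_isGreatest ⟨0, ⟨le_rfl, hT⟩, h0⟩
  have hsa' : f s ≤ a := hsa
  have hsT' : s < T := lt_of_le_of_ne hsT (by rintro rfl; exact absurd hsa' hlt.not_ge)
  have habove : ∀ t ∈ Set.Ioo s T, a < f t := by
    intro t ht
    by_contra! hle
    exact absurd (hmax ⟨⟨hs0.trans ht.1.le, ht.2.le⟩, hle⟩) ht.1.not_ge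
  have hIoo : Set.Ioo s T ∈ nhdsWithin s (Set.Ioi s) := Ioo_mem_nhdsGT hsT'
  have hfs : f s = a := by
    refine le_antisymm hsa' (ge_of_tendsto
      (hf.continuous.continuousAt.tendsto.mono_left (nhdsWithin_le_nhds (s := Set.Ioi s))) ?_)
    filter_upwards [hIoo] with t ht using (habove t ht).le
  have hlim : Filter.Tendsto (deriv f) (nhdsWithin s (Set.Ioi s)) (nhds c) := by
    refine tendsto_const_nhds.congr' ?_
    filter_upwards [hIoo, nhdsWithin_le_nhds (hjump s hs0 hfs)] with t ht hjt
    exact (hjt (hs0.trans ht.1.le) (habove t ht)).symm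
  have hright : HasDerivWithinAt f c (Set.Ici s) s :=
    hasDerivWithinAt_Ici_of_tendsto_deriv hf.differentiableOn
      hf.continuous.continuousWithinAt hIoo hlim
  have hleft : HasDerivWithinAt f 0 (Set.Ici s) s := by
    have := (hf s).hasDerivAt.hasDerivWithinAt (s := Set.Ici s)
    rwa [hzero s hs0 hfs] at this
  exact hc ((uniqueDiffOn_Ici s s Set.self_mem_Ici).eq_deriv _ hright hleft)

/-- Explicit solution of the linear relaxation equation `f' = r * (a − f)` on `[0, ∞)`. -/
theorem eq_exp_of_deriv_eq_mul_sub {f : ℝ → ℝ} {a r : ℝ} (hf : Differentiable ℝ f)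
    (hode : ∀ t, 0 ≤ t → deriv f t = r * (a - f t)) {t : ℝ} (ht : 0 ≤ t) :
    f t = a - (a - f 0) * Real.exp (-(r * t)) := by
  have hderiv : ∀ x, 0 ≤ x → HasDerivAt (fun y => (f y - a) * Real.exp (r * y)) 0 x := by
    intro x hx
    have hexp : HasDerivAt (fun y => Real.exp (r * y)) (Real.exp (r * x) * (r * 1)) x :=
      ((hasDerivAt_id x).const_mul r).exp
    refine (((hf x).hasDerivAt.sub_const a).mul hexp).congr_deriv ?_
    rw [hode x hx]
    ring
  have hconst := constant_of_has_deriv_right_zero (a := 0) (b := t)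
    (fun x hx => (hderiv x hx.1).continuousAt.continuousWithinAt)
    (fun x hx => (hderiv x hx.1).hasDerivWithinAt) t ⟨ht, le_rfl⟩
  simp only [mul_zero, Real.exp_zero, mul_one] at hconst
  rw [Real.exp_neg]
  have := Real.exp_ne_zero (r * t)
  field_simp
  linarith

/-- With demand `d⁻ ≥ C` and the constant optimal speed limit `u = v1`, a solution
of the link queue ODE with `k(0) = k0 ≤ k1` is `k(t) = k1 − (k1 − k0)*exp(−v_f t/l0)`;
in particular `k(t) → k1` and `G(k(t)) → C`. -/
theorem optimal_speed_limit_uncongested_solution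
    (vf w kj C Δ dm l0 k0 : ℝ)
    (hvf : 0 < vf) (hw : 0 < w) (hkj : 0 < kj)
    (hC0 : 0 < C) (hCub : C < vf * w * kj / (vf + w))
    (hΔ0 : 0 < Δ) (hΔ1 : Δ < 1)
    (hl0 : 0 < l0) (hdm : C ≤ dm)
    (k : ℝ → ℝ) (hk : Differentiable ℝ k)
    (hode : ∀ t : ℝ, 0 ≤ t →
      l0 * deriv k t =
        influx dm w kj (C * w / (kj * w - C)) (k t) - outflux vf C Δ (k t))
    (hk0 : k 0 = k0) (hk0le : k0 ≤ C / vf) :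
    (∀ t : ℝ, 0 ≤ t → k t = C / vf - (C / vf - k0) * Real.exp (-(vf * t) / l0)) ∧
    Filter.Tendsto k Filter.atTop (nhds (C / vf)) ∧
    Filter.Tendsto (fun t => outflux vf C Δ (k t)) Filter.atTop (nhds C) := by
  have hcap : C * (vf + w) < vf * w * kj := (lt_div_iff₀ (by positivity)).1 hCub
  have hsupply : C < w * (kj - C / vf) := by
    have : w * (kj - C / vf) = (vf * w * kj - C * w) / vf := by field_simp
    rw [this, lt_div_iff₀ hvf]
    linarith
  have hCkj : C < kj * w := by
    have : 0 < w * (C / vf) := by positivity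
    linarith
  have hflow : ∀ t, 0 ≤ t → k t ≤ C / vf → deriv k t = vf / l0 * (C / vf - k t) := by
    intro t ht hle
    have hsup : C ≤ w * (kj - k t) :=
      hsupply.le.trans (mul_le_mul_of_nonneg_left (by linarith) hw.le)
    have h := hode t ht
    rw [influx_optimal_speed_limit hw hkj hCkj hdm hsup, outflux, if_pos hle] at h
    field_simp
    linarith
  have hle : ∀ t, 0 ≤ t → k t ≤ C / vf := by
    intro t ht
    refine le_of_deriv_jump (c := Δ * C / l0) hk (by positivity) (hk0 ▸ hk0le) ?_ ?_ ht
    · intro s hs hks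
      rw [hflow s hs hks.le, hks, sub_self, mul_zero]
    · intro s hs hks
      have hcont : ContinuousAt (fun x => w * (kj - k x)) s :=
        (continuous_const.mul (continuous_const.sub hk.continuous)).continuousAt
      have hev : ∀ᶠ x in nhds s, C < w * (kj - k x) :=
        hcont.eventually_const_lt (by simpa only [hks] using hsupply)
      filter_upwards [hev] with x hx hx0 hkx
      have h := hode x hx0
      rw [influx_optimal_speed_limit hw hkj hCkj hdm hx.le, outflux, if_neg hkx.not_ge] at h
      field_simp
      linarith
  have hsol : ∀ t : ℝ, 0 ≤ t →
      k t = C / vf - (C / vf - k0) * Real.exp (-(vf * t) / l0) := by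
    intro t ht
    have h := eq_exp_of_deriv_eq_mul_sub hk (fun x hx => hflow x hx (hle x hx)) ht
    rwa [hk0, show -(vf / l0 * t) = -(vf * t) / l0 by ring] at h
  have hexp : Filter.Tendsto (fun t => Real.exp (-(vf * t) / l0)) Filter.atTop (nhds 0) := by
    have hlin : Filter.Tendsto (fun t => vf / l0 * t) Filter.atTop Filter.atTop :=
      Filter.tendsto_id.const_mul_atTop (by positivity)
    refine (Real.tendsto_exp_neg_atTop_nhds_zero.comp hlin).congr fun t => ?_
    rw [Function.comp_apply, show -(vf / l0 * t) = -(vf * t) / l0 by ring]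
  have hlim : Filter.Tendsto k Filter.atTop (nhds (C / vf)) := by
    have h := (hexp.const_mul (C / vf - k0)).const_sub (C / vf)
    rw [mul_zero, sub_zero] at h
    refine h.congr' ?_
    filter_upwards [Filter.eventually_ge_atTop 0] with t ht using (hsol t ht).symm
  refine ⟨hsol, hlim, ?_⟩
  have h := hlim.const_mul vf
  rw [mul_div_cancel₀ C hvf.ne'] at h
  refine h.congr' ?_
  filter_upwards [Filter.eventually_ge_atTop 0] with t ht
  rw [outflux, if_pos (hle t ht)]
end

section
/- With demand d⁻ ≥ C and the constant optimal speed limit u = v1 = C*w/(k_j*w − C), the uncongested equilibrium k1 is unstable to positive perturbations: if k : [0,∞) → ℝ is differentiable, satisfies l0*k'(t) = F(v1, k(t)) − G(k(t)) for all t ≥ 0, and k(0) ∈ (k1, k2), then k(t) > k1 for all t ≥ 0, k is strictly increasing as long as k(t) < k2, and the discharging flow-rate equals the dropped capacity, G(k(t)) = (1−Δ)C, for all t ≥ 0. -/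
/-- At the speed limit `v1 = C*w/(k_j*w − C)` the speed-limit capacity equals `C`. -/
lemma speedLimit_capacity_eq {w kj C : ℝ} (hw : w ≠ 0) (hkj : kj ≠ 0) (hC : C < w * kj) :
    C * w / (kj * w - C) * w * kj / (C * w / (kj * w - C) + w) = C := by
  have h : kj * w - C ≠ 0 := by linarith [mul_comm w kj]
  have hsum : C * w / (kj * w - C) + w = kj * w ^ 2 / (kj * w - C) := by
    rw [div_add' _ _ _ h]
    ring
  rw [hsum, div_mul_eq_mul_div, div_mul_eq_mul_div, div_div_div_cancel_right₀ h]
  field_simp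

/-- Under the speed limit `v1`, the in-flux exceeds the dropped capacity below `k2`. -/
lemma droppedCapacity_lt_influx {w kj C Δ dm x : ℝ} (hw : 0 < w) (hkj : 0 < kj)
    (hC0 : 0 < C) (hC : C < w * kj) (hΔ : 0 < Δ) (hdm : C ≤ dm)
    (hx : x < kj - (1 - Δ) * C / w) :
    (1 - Δ) * C < influx dm w kj (C * w / (kj * w - C)) x := by
  have hdrop : (1 - Δ) * C < C := by nlinarith
  have hcong : (1 - Δ) * C < w * (kj - x) := by
    have h : (1 - Δ) * C / w < kj - x := by linarith
    rwa [div_lt_iff₀' hw] at h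
  rw [influx, speedLimit_capacity_eq hw.ne' hkj.ne' hC]
  exact lt_min (hdrop.trans_le hdm) (lt_min hdrop hcong)

/-- Above the critical density, the out-flux is the dropped capacity. -/
lemma outflux_of_lt {vf C Δ x : ℝ} (hx : C / vf < x) : outflux vf C Δ x = (1 - Δ) * C :=
  if_neg hx.not_ge

/-- With demand `d⁻ ≥ C` and the constant optimal speed limit `u = v1`, the
uncongested equilibrium `k1` is unstable to positive perturbations: a solution with
`k(0) ∈ (k1, k2)` stays above `k1`, is strictly increasing as long as `k(t) < k2`,
and its discharging flow-rate equals the dropped capacity `(1−Δ)C`. -/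
theorem optimal_speed_limit_unstable_to_positive_disturbance
    (vf w kj C Δ dm l0 : ℝ)
    (hvf : 0 < vf) (hw : 0 < w) (hkj : 0 < kj)
    (hC0 : 0 < C) (hCub : C < vf * w * kj / (vf + w))
    (hΔ0 : 0 < Δ) (hΔ1 : Δ < 1)
    (hl0 : 0 < l0) (hdm : C ≤ dm)
    (k : ℝ → ℝ) (hk : Differentiable ℝ k)
    (hode : ∀ t : ℝ, 0 ≤ t →
      l0 * deriv k t =
        influx dm w kj (C * w / (kj * w - C)) (k t) - outflux vf C Δ (k t))
    (hk0l : C / vf < k 0) (hk0u : k 0 < kj - (1 - Δ) * C / w) :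
    (∀ t : ℝ, 0 ≤ t → C / vf < k t) ∧
    (∀ t : ℝ, 0 ≤ t → k t < kj - (1 - Δ) * C / w → 0 < deriv k t) ∧
    (∀ t : ℝ, 0 ≤ t → outflux vf C Δ (k t) = (1 - Δ) * C) := by
  have hC : C < w * kj := by
    rw [lt_div_iff₀ (by positivity)] at hCub
    nlinarith [mul_pos hC0 hw]
  have hderiv : ∀ t, 0 ≤ t → C / vf < k t → k t < kj - (1 - Δ) * C / w → 0 < deriv k t := by
    intro t ht hl hu
    have h := droppedCapacity_lt_influx hw hkj hC0 hC hΔ0 hdm hu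
    have ho := hode t ht
    rw [outflux_of_lt hl] at ho
    exact pos_of_mul_pos_right (by linarith : 0 < l0 * deriv k t) hl0.le
  have hge : ∀ t, 0 ≤ t → k 0 ≤ k t := fun t ht =>
    image_le_of_deriv_right_lt_deriv_boundary (f := fun _ => k 0) (f' := fun _ => 0)
      continuousOn_const (fun x _ => hasDerivWithinAt_const x _ _) le_rfl
      (fun x => (hk x).hasDerivAt)
      (fun x hx hkx => hderiv x hx.1 (hkx ▸ hk0l) (hkx ▸ hk0u))
      (Set.right_mem_Icc.2 ht)
  have hgt : ∀ t, 0 ≤ t → C / vf < k t := fun t ht => hk0l.trans_le (hge t ht)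
  exact ⟨hgt, fun t ht => hderiv t ht (hgt t ht), fun t ht => outflux_of_lt (hgt t ht)⟩
end

section
/- With demand d⁻ ≥ C and the constant speed limit u = v1 = C*w/(k_j*w − C), the congested equilibrium k2 is exponentially stable: if k : [0,∞) → ℝ is differentiable, satisfies l0*k'(t) = F(v1, k(t)) − G(k(t)) for all t ≥ 0, and k(0) = k0 ∈ [k_j − C/w, k_j], then k(t) = k2 + (k0 − k2)*exp(−w*t/l0) for all t ≥ 0; in particular |k(t) − k2| = |k0 − k2|*exp(−w*t/l0). -/
/-- Under the speed limit `v1`, the flow-rate allowed by the speed limit equals the capacity. -/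
theorem speed_limit_flow_eq_capacity {w kj C : ℝ} (hw : 0 < w) (hkj : 0 < kj)
    (hC : C < kj * w) :
    C * w / (kj * w - C) * w * kj / (C * w / (kj * w - C) + w) = C := by
  have h : kj * w - C ≠ 0 := (sub_pos.2 hC).ne'
  have h' : C * w / (kj * w - C) + w = w * w * kj / (kj * w - C) := by
    rw [div_add' _ _ _ h]
    ring
  rw [h', div_mul_eq_mul_div, div_mul_eq_mul_div, div_div_div_cancel_right₀ h,
    div_eq_iff (by positivity)]
  ring

/-- Above the density `kj - C / w`, the link queue model is linear under the speed limit `v1`. -/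
theorem influx_sub_outflux_of_congested {vf w kj C Δ dm x : ℝ} (hvf : 0 < vf) (hw : 0 < w)
    (hkj : 0 < kj) (hC0 : 0 < C) (hC : C < vf * w * kj / (vf + w)) (hdm : C ≤ dm)
    (hx : kj - C / w ≤ x) :
    influx dm w kj (C * w / (kj * w - C)) x - outflux vf C Δ x =
      -w * (x - (kj - (1 - Δ) * C / w)) := by
  have hcrit := critical_density_lt_congested_density hvf hw hC
  have hCw : C < kj * w := by
    have : 0 < C / vf := by positivity
    rw [← div_lt_iff₀ hw]
    linarith
  have hle : w * (kj - x) ≤ C := by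
    have : kj - x ≤ C / w := by linarith
    rw [le_div_iff₀ hw] at this
    linarith
  rw [influx, outflux, speed_limit_flow_eq_capacity hw hkj hCw, min_eq_right hle,
    min_eq_right (hle.trans hdm), if_neg (by linarith)]
  field_simp
  ring

/-- A solution of `l * f' = -w * (f - c)` on `[0, ∞)` relaxes exponentially to `c`. -/
theorem eq_add_mul_exp_of_linear_ode {f : ℝ → ℝ} {l w c : ℝ} (hl : l ≠ 0)
    (hf : Differentiable ℝ f) (hode : ∀ t, 0 ≤ t → l * deriv f t = -w * (f t - c))
    {t : ℝ} (ht : 0 ≤ t) : f t = c + (f 0 - c) * Real.exp (-(w * t) / l) := by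
  have hder : ∀ s, 0 ≤ s →
      HasDerivAt (fun s => (f s - c) * Real.exp (w * s / l)) 0 s := by
    intro s hs
    have hexp : HasDerivAt (fun s => Real.exp (w * s / l)) (Real.exp (w * s / l) * (w / l)) s := by
      have := (((hasDerivAt_id s).const_mul w).div_const l).exp
      simpa using this
    have hd : deriv f s = -w * (f s - c) / l := by
      rw [eq_div_iff hl, mul_comm, hode s hs]
    refine (((hf s).hasDerivAt.sub_const c).mul hexp).congr_deriv ?_
    rw [hd]
    field_simp
    ring
  have hconst := constant_of_has_deriv_right_zero
    (fun s hs => (hder s hs.1).continuousAt.continuousWithinAt)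
    (fun s hs => (hder s hs.1).hasDerivWithinAt) t (Set.right_mem_Icc.2 ht)
  simp only [mul_zero, zero_div, Real.exp_zero, mul_one] at hconst
  rw [← hconst, mul_assoc, ← Real.exp_add, neg_div, add_neg_cancel, Real.exp_zero]
  ring

/-- With demand `d⁻ ≥ C` and the constant speed limit `u = v1`, the congested
equilibrium `k2` is exponentially stable: a solution with
`k(0) = k0 ∈ [k_j − C/w, k_j]` is `k(t) = k2 + (k0 − k2)*exp(−w t/l0)`, so
`|k(t) − k2| = |k0 − k2|*exp(−w t/l0)`. -/
theorem congested_equilibrium_exponentially_stable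
    (vf w kj C Δ dm l0 k0 : ℝ)
    (hvf : 0 < vf) (hw : 0 < w) (hkj : 0 < kj)
    (hC0 : 0 < C) (hCub : C < vf * w * kj / (vf + w))
    (hΔ0 : 0 < Δ) (hΔ1 : Δ < 1)
    (hl0 : 0 < l0) (hdm : C ≤ dm)
    (k : ℝ → ℝ) (hk : Differentiable ℝ k)
    (hode : ∀ t : ℝ, 0 ≤ t →
      l0 * deriv k t =
        influx dm w kj (C * w / (kj * w - C)) (k t) - outflux vf C Δ (k t))
    (hk0 : k 0 = k0) (hk0l : kj - C / w ≤ k0) (hk0u : k0 ≤ kj) :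
    (∀ t : ℝ, 0 ≤ t →
      k t = (kj - (1 - Δ) * C / w) + (k0 - (kj - (1 - Δ) * C / w)) * Real.exp (-(w * t) / l0)) ∧
    (∀ t : ℝ, 0 ≤ t →
      |k t - (kj - (1 - Δ) * C / w)| = |k0 - (kj - (1 - Δ) * C / w)| * Real.exp (-(w * t) / l0)) := by
  have hinv : ∀ t, 0 ≤ t → kj - C / w ≤ k t := by
    intro t ht
    have h := image_le_of_deriv_right_lt_deriv_boundary (f := fun s => -k s)
      (f' := fun s => -deriv k s) (B := fun _ => -(kj - C / w)) (B' := fun _ => 0) (a := 0) (b := t)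
      hk.continuous.neg.continuousOn (fun s _ => (hk s).hasDerivAt.neg.hasDerivWithinAt)
      (by rw [hk0]; linarith) (fun s => hasDerivAt_const s _)
      (fun s hs heq => by
        have hks : k s = kj - C / w := neg_injective heq
        have hd := hode s hs.1
        rw [influx_sub_outflux_of_congested hvf hw hkj hC0 hCub hdm hks.ge, hks] at hd
        have hrate : -w * (kj - C / w - (kj - (1 - Δ) * C / w)) = Δ * C := by
          field_simp
          ring
        have hpos : 0 < l0 * deriv k s := by
          rw [hd, hrate]
          positivity
        exact neg_neg_of_pos (pos_of_mul_pos_right hpos hl0.le))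
      (Set.right_mem_Icc.2 ht)
    exact neg_le_neg_iff.1 h
  have hsol : ∀ t : ℝ, 0 ≤ t → k t = (kj - (1 - Δ) * C / w) +
      (k0 - (kj - (1 - Δ) * C / w)) * Real.exp (-(w * t) / l0) := by
    intro t ht
    rw [← hk0]
    exact eq_add_mul_exp_of_linear_ode hl0.ne' hk (fun s hs => (hode s hs).trans
      (influx_sub_outflux_of_congested hvf hw hkj hC0 hCub hdm (hinv s hs))) ht
  refine ⟨hsol, fun t ht => ?_⟩
  rw [hsol t ht, add_sub_cancel_left, abs_mul, Real.abs_exp]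
end

section
/- With demand satisfying (1−Δ)C < d⁻ ≤ C and the constant speed limit u = v1 = C*w/(k_j*w − C), the uncongested equilibrium d⁻/v_f is exponentially stable with respect to initial densities not exceeding k1: if k : [0,∞) → ℝ is differentiable, satisfies l0*k'(t) = F(v1, k(t)) − G(k(t)) for all t ≥ 0, and k(0) = k0 ≤ k1, then k(t) = d⁻/v_f + (k0 − d⁻/v_f)*exp(−v_f*t/l0) for all t ≥ 0. -/
open Filter Topology Set

/-- At the speed limit `u = C*w/(k_j*w - C)` the in-flux equals the demand as long as the
receiving flow `w*(k_j - k)` is at least `C`. -/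
theorem influx_eq_demand_s12 {dm w kj C κ : ℝ} (hw : 0 < w) (hkj : 0 < kj) (hC : C < kj * w)
    (hdm : dm ≤ C) (hκ : C ≤ w * (kj - κ)) :
    influx dm w kj (C * w / (kj * w - C)) κ = dm := by
  have h : kj * w - C ≠ 0 := (sub_pos.mpr hC).ne'
  have hsum : C * w / (kj * w - C) + w = kj * w ^ 2 / (kj * w - C) := by
    rw [div_add' _ _ _ h]
    ring
  have hcap : C * w / (kj * w - C) * w * kj / (C * w / (kj * w - C) + w) = C := by
    rw [hsum, div_mul_eq_mul_div, div_mul_eq_mul_div, div_div_div_cancel_right₀ h,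
      div_eq_iff (by positivity)]
    ring
  rw [influx, hcap]
  exact min_eq_left (le_min hdm (hdm.trans hκ))

/-- A differentiable function starting below `K` stays below `K` on `[0, ∞)` if its derivative is
nonpositive whenever it hits `K` and equals a positive constant slightly above `K`. -/
theorem le_of_deriv_jump_s12 {k : ℝ → ℝ} {K K' c : ℝ} (hk : Differentiable ℝ k) (hK : K < K')
    (hc : 0 < c) (hhit : ∀ t, 0 ≤ t → k t = K → deriv k t ≤ 0)
    (habove : ∀ t, 0 ≤ t → K < k t → k t < K' → deriv k t = c) (h0 : k 0 ≤ K)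
    {t : ℝ} (ht : 0 ≤ t) : k t ≤ K := by
  by_contra! hlt
  have hcompact : IsCompact (Icc 0 t ∩ k ⁻¹' Iic K) :=
    isCompact_Icc.inter_right (isClosed_Iic.preimage hk.continuous)
  obtain ⟨s, ⟨⟨hs0, hst⟩, hsK⟩, hmax⟩ :=
    hcompact.exists_isGreatest ⟨0, ⟨le_refl 0, ht⟩, h0⟩
  have hsK : k s ≤ K := hsK
  have hst : s < t := lt_of_le_of_ne hst (by rintro rfl; linarith)
  have hafter : ∀ x ∈ Ioo s t, K < k x := by
    intro x hx
    by_contra! hxK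
    exact absurd (hmax ⟨⟨hs0.trans hx.1.le, hx.2.le⟩, hxK⟩) (not_le.mpr hx.1)
  have hnear : ∀ᶠ x in 𝓝[>] s, x ∈ Ioo s t := Ioo_mem_nhdsGT hst
  have hlim : Tendsto k (𝓝[>] s) (𝓝 (k s)) := hk.continuous.continuousAt.continuousWithinAt
  have hsK' : k s = K :=
    le_antisymm hsK (ge_of_tendsto hlim (hnear.mono fun x hx => (hafter x hx).le))
  have hderiv : Tendsto (deriv k) (𝓝[>] s) (𝓝 c) := by
    refine tendsto_const_nhds.congr' ?_
    filter_upwards [hnear, hlim.eventually (gt_mem_nhds (hsK.trans_lt hK))] with x hx hxK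
    exact (habove x (hs0.trans hx.1.le) (hafter x hx) hxK).symm
  have hright : HasDerivWithinAt k c (Ici s) s :=
    hasDerivWithinAt_Ici_of_tendsto_deriv hk.differentiableOn
      hk.continuous.continuousAt.continuousWithinAt (self_mem_nhdsWithin : Ioi s ∈ 𝓝[>] s) hderiv
  have heq : deriv k s = c :=
    (uniqueDiffWithinAt_Ici s).eq_deriv _ (hk s).hasDerivAt.hasDerivWithinAt hright
  linarith [hhit s hs0 hsK']

/-- Explicit solution of the scalar linear equation `k' = -a (k - b)` on `[0, ∞)`. -/
theorem eq_exp_of_deriv_eq {k : ℝ → ℝ} {a b : ℝ} (hk : Differentiable ℝ k)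
    (hode : ∀ t, 0 ≤ t → deriv k t = -a * (k t - b)) {t : ℝ} (ht : 0 ≤ t) :
    k t = b + (k 0 - b) * Real.exp (-(a * t)) := by
  have hder : ∀ x, 0 ≤ x →
      HasDerivAt (fun y => (k y - b) * Real.exp (a * y)) 0 x := by
    intro x hx
    have hexp : HasDerivAt (fun y => Real.exp (a * y)) (Real.exp (a * x) * (a * 1)) x :=
      ((hasDerivAt_id x).const_mul a).exp
    refine (((hk x).hasDerivAt.sub_const b).mul hexp).congr_deriv ?_
    rw [hode x hx]
    ring
  have hconst := constant_of_has_deriv_right_zero (a := 0) (b := t)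
    (fun x hx => (hder x hx.1).continuousAt.continuousWithinAt)
    (fun x hx => (hder x hx.1).hasDerivWithinAt) t ⟨ht, le_rfl⟩
  simp only [mul_zero, Real.exp_zero, mul_one] at hconst
  rw [← hconst, mul_assoc, ← Real.exp_add]
  simp


/-- With demand `(1−Δ)C < d⁻ ≤ C` and the constant speed limit `u = v1`, the
uncongested equilibrium `d⁻/v_f` is exponentially stable for initial densities not
exceeding `k1`: the solution is `k(t) = d⁻/v_f + (k0 − d⁻/v_f)*exp(−v_f t/l0)`. -/
theorem medium_demand_uncongested_exponentially_stable
    (vf w kj C Δ dm l0 k0 : ℝ)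
    (hvf : 0 < vf) (hw : 0 < w) (hkj : 0 < kj)
    (hC0 : 0 < C) (hCub : C < vf * w * kj / (vf + w))
    (hΔ0 : 0 < Δ) (hΔ1 : Δ < 1)
    (hl0 : 0 < l0) (hdm1 : (1 - Δ) * C < dm) (hdm2 : dm ≤ C)
    (k : ℝ → ℝ) (hk : Differentiable ℝ k)
    (hode : ∀ t : ℝ, 0 ≤ t →
      l0 * deriv k t =
        influx dm w kj (C * w / (kj * w - C)) (k t) - outflux vf C Δ (k t))
    (hk0 : k 0 = k0) (hk0le : k0 ≤ C / vf) :
    ∀ t : ℝ, 0 ≤ t →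
      k t = dm / vf + (k0 - dm / vf) * Real.exp (-(vf * t) / l0) := by
  have hCub' : C * (vf + w) < vf * w * kj := (lt_div_iff₀ (by positivity)).mp hCub
  have hCkj : C < kj * w := by nlinarith [mul_pos hC0 hw]
  have hK : C / vf < kj - C / w := by
    rw [lt_sub_iff_add_lt, div_add_div _ _ hvf.ne' hw.ne', div_lt_iff₀ (by positivity)]
    linarith
  have hin : ∀ κ, κ ≤ kj - C / w →
      influx dm w kj (C * w / (kj * w - C)) κ = dm := by
    intro κ hκ
    refine influx_eq_demand_s12 hw hkj hCkj hdm2 ?_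
    have : C / w ≤ kj - κ := by linarith
    rwa [div_le_iff₀' hw] at this
  have hbelow : ∀ t, 0 ≤ t → k t ≤ C / vf → deriv k t = -(vf / l0) * (k t - dm / vf) := by
    intro t ht hle
    have h := hode t ht
    rw [hin _ (hle.trans hK.le), outflux, if_pos hle] at h
    field_simp
    linarith
  have hbound : ∀ t, 0 ≤ t → k t ≤ C / vf := by
    intro t ht
    refine le_of_deriv_jump_s12 (c := (dm - (1 - Δ) * C) / l0) hk hK
      (div_pos (sub_pos.mpr hdm1) hl0) ?_ ?_ (hk0.trans_le hk0le) ht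
    · intro s hs heq
      rw [hbelow s hs heq.le, heq, neg_mul, neg_nonpos, ← sub_div]
      exact mul_nonneg (by positivity) (div_nonneg (sub_nonneg.mpr hdm2) hvf.le)
    · intro s hs hgt hlt
      have h := hode s hs
      rw [hin _ hlt.le, outflux, if_neg (not_le.mpr hgt)] at h
      rw [eq_div_iff hl0.ne']
      linarith
  intro t ht
  rw [eq_exp_of_deriv_eq hk (fun s hs => hbelow s hs (hbound s hs)) ht, hk0, neg_div,
    div_mul_eq_mul_div]
end

section
/- With demand satisfying (1−Δ)C < d⁻ ≤ C and the constant speed limit u = v1 = C*w/(k_j*w − C), a sufficiently large positive disturbance drives the system away from the uncongested equilibrium: if k : [0,∞) → ℝ is differentiable, satisfies l0*k'(t) = F(v1, k(t)) − G(k(t)) for all t ≥ 0, and k(0) ∈ (k1, k2), then k(t) > k1 for all t ≥ 0, k is strictly increasing as long as k(t) < k2, k(t) → k2 as t → ∞, and the discharging flow-rate equals (1−Δ)C for all t ≥ 0. -/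
/-- At the speed limit `v1` the capacity term of the in-flux equals `C`. -/
lemma influx_critical_speed {dm w kj C : ℝ} (hw : 0 < w) (hkj : 0 < kj)
    (hC : C < kj * w) (hdm : dm ≤ C) (x : ℝ) :
    influx dm w kj (C * w / (kj * w - C)) x = min dm (w * (kj - x)) := by
  have h : w * kj - C ≠ 0 := by linarith
  rw [mul_comm kj w]
  have hsum : C * w / (w * kj - C) + w = w ^ 2 * kj / (w * kj - C) := by
    field_simp
    ring
  have hcap : C * w / (w * kj - C) * w * kj / (C * w / (w * kj - C) + w) = C := by
    rw [hsum]
    field_simp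
  rw [influx, hcap, ← min_assoc, min_eq_left hdm]

/-- A differentiable function that has positive derivative whenever it takes its initial value
never drops below that value. -/
lemma initial_le_of_deriv_pos {k : ℝ → ℝ} (hk : Differentiable ℝ k)
    (h : ∀ t, 0 ≤ t → k t = k 0 → 0 < deriv k t) {t : ℝ} (ht : 0 ≤ t) : k 0 ≤ k t := by
  have := image_le_of_deriv_right_lt_deriv_boundary (f := fun x => -k x)
    (f' := fun x => -deriv k x) (a := 0) (b := t) (B := fun _ => -k 0) (B' := fun _ => 0)
    hk.continuous.neg.continuousOn
    (fun x _ => (hk x).hasDerivAt.neg.hasDerivWithinAt) le_rfl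
    (fun x => hasDerivAt_const x _)
    (fun x hx hxk => by
      have := h x hx.1 (neg_injective hxk)
      linarith)
  simpa using this ⟨ht, le_rfl⟩

/-- If `D * deriv D ≤ -a D²` on `[0, ∞)` with `a > 0`, then `D` tends to zero. -/
lemma tendsto_zero_of_mul_deriv_le {D : ℝ → ℝ} (hD : Differentiable ℝ D) {a : ℝ} (ha : 0 < a)
    (h : ∀ t, 0 ≤ t → D t * deriv D t ≤ -a * D t ^ 2) :
    Filter.Tendsto D Filter.atTop (nhds 0) := by
  have hder (t : ℝ) : HasDerivAt (fun t => D t ^ 2 * Real.exp (2 * a * t))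
      (2 * (D t * deriv D t + a * D t ^ 2) * Real.exp (2 * a * t)) t := by
    have h1 := ((hD t).hasDerivAt.pow 2).mul (((hasDerivAt_id t).const_mul (2 * a)).exp)
    refine h1.congr_deriv ?_
    simp
    ring
  have hanti : AntitoneOn (fun t => D t ^ 2 * Real.exp (2 * a * t)) (Set.Ici 0) := by
    refine antitoneOn_of_deriv_nonpos (convex_Ici 0)
      (fun t _ => (hder t).continuousAt.continuousWithinAt)
      (fun t _ => (hder t).differentiableAt.differentiableWithinAt) fun t ht => ?_
    rw [interior_Ici] at ht
    rw [(hder t).deriv]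
    have := h t (le_of_lt ht)
    exact mul_nonpos_of_nonpos_of_nonneg (by linarith) (Real.exp_pos _).le
  have hexp : Filter.Tendsto (fun t => D 0 ^ 2 * Real.exp (-(2 * a * t))) Filter.atTop
      (nhds 0) := by
    have := (Real.tendsto_exp_neg_atTop_nhds_zero.comp
      (Filter.tendsto_id.const_mul_atTop (by positivity : 0 < 2 * a))).const_mul (D 0 ^ 2)
    simpa using this
  have hsq : Filter.Tendsto (fun t => D t ^ 2) Filter.atTop (nhds 0) := by
    refine tendsto_of_tendsto_of_tendsto_of_le_of_le' tendsto_const_nhds hexp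
      (Filter.Eventually.of_forall fun t => sq_nonneg _) ?_
    filter_upwards [Filter.eventually_ge_atTop 0] with t ht
    have h0 := hanti (Set.mem_Ici.2 le_rfl) (Set.mem_Ici.2 ht) ht
    simp only [mul_zero, Real.exp_zero, mul_one] at h0
    rw [Real.exp_neg, ← div_eq_mul_inv, le_div_iff₀ (Real.exp_pos _)]
    exact h0
  have habs := hsq.sqrt
  simp only [Real.sqrt_sq_eq_abs, Real.sqrt_zero] at habs
  exact (tendsto_zero_iff_abs_tendsto_zero D).2 habs

/-- With demand `(1−Δ)C < d⁻ ≤ C` and the constant speed limit `u = v1`, a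
sufficiently large positive disturbance drives the system away from the uncongested
equilibrium: a solution with `k(0) ∈ (k1, k2)` stays above `k1`, is strictly
increasing as long as `k(t) < k2`, converges to `k2`, and its discharging
flow-rate equals `(1−Δ)C` for all time. -/
theorem medium_demand_large_disturbance_drifts_to_congestion
    (vf w kj C Δ dm l0 : ℝ)
    (hvf : 0 < vf) (hw : 0 < w) (hkj : 0 < kj)
    (hC0 : 0 < C) (hCub : C < vf * w * kj / (vf + w))
    (hΔ0 : 0 < Δ) (hΔ1 : Δ < 1)
    (hl0 : 0 < l0) (hdm1 : (1 - Δ) * C < dm) (hdm2 : dm ≤ C)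
    (k : ℝ → ℝ) (hk : Differentiable ℝ k)
    (hode : ∀ t : ℝ, 0 ≤ t →
      l0 * deriv k t =
        influx dm w kj (C * w / (kj * w - C)) (k t) - outflux vf C Δ (k t))
    (hk0l : C / vf < k 0) (hk0u : k 0 < kj - (1 - Δ) * C / w) :
    (∀ t : ℝ, 0 ≤ t → C / vf < k t) ∧
    (∀ t : ℝ, 0 ≤ t → k t < kj - (1 - Δ) * C / w → 0 < deriv k t) ∧
    Filter.Tendsto k Filter.atTop (nhds (kj - (1 - Δ) * C / w)) ∧
    (∀ t : ℝ, 0 ≤ t → outflux vf C Δ (k t) = (1 - Δ) * C) := by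
  have hCw : C < kj * w := by
    refine hCub.trans ?_
    rw [div_lt_iff₀ (by positivity)]
    nlinarith [mul_pos (mul_pos hkj hw) hw]
  set s := (1 - Δ) * C with hs
  set k2 := kj - s / w with hk2
  have hwk (x : ℝ) : w * (kj - x) - s = w * (k2 - x) := by
    rw [hk2]
    field_simp
    ring
  have hcong (x : ℝ) (hx : C / vf < x) : outflux vf C Δ x = s := by
    rw [outflux, if_neg hx.not_ge]
  have hode' (t : ℝ) (ht : 0 ≤ t) (hx : C / vf < k t) :
      l0 * deriv k t = min (dm - s) (w * (k2 - k t)) := by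
    rw [hode t ht, hcong _ hx, influx_critical_speed hw hkj hCw hdm2, ← hwk, min_sub_sub_right]
  have hpos (t : ℝ) (ht : 0 ≤ t) (hx : C / vf < k t) (hx2 : k t < k2) : 0 < deriv k t := by
    refine pos_of_mul_pos_right ?_ hl0.le
    rw [hode' t ht hx]
    exact lt_min (sub_pos.2 hdm1) (mul_pos hw (sub_pos.2 hx2))
  have hge (t : ℝ) (ht : 0 ≤ t) : k 0 ≤ k t :=
    initial_le_of_deriv_pos hk
      (fun x hx hxk => hpos x hx (hxk ▸ hk0l) (hxk ▸ hk0u)) ht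
  have hgt (t : ℝ) (ht : 0 ≤ t) : C / vf < k t := hk0l.trans_le (hge t ht)
  refine ⟨hgt, fun t ht => hpos t ht (hgt t ht), ?_, fun t ht => hcong _ (hgt t ht)⟩
  have hD0 : 0 < k2 - k 0 := sub_pos.2 hk0u
  have hδ : 0 < dm - s := sub_pos.2 hdm1
  obtain ⟨c, hc⟩ : ∃ c, c = min w ((dm - s) / (k2 - k 0)) := ⟨_, rfl⟩
  have hc0 : 0 < c := hc ▸ lt_min hw (div_pos hδ hD0)
  have hcw : c ≤ w := hc ▸ min_le_left _ _
  have hcδ : c * (k2 - k 0) ≤ dm - s := by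
    rw [← le_div_iff₀ hD0, hc]
    exact min_le_right _ _
  have hlim := tendsto_zero_of_mul_deriv_le (D := fun t => k2 - k t) (hk.const_sub k2)
    (div_pos hc0 hl0) fun t ht => by
      have hd : deriv (fun t => k2 - k t) t = -(min (dm - s) (w * (k2 - k t)) / l0) := by
        rw [deriv_const_sub, ← hode' t ht (hgt t ht), mul_div_cancel_left₀ _ hl0.ne']
      have hmin : c * (k2 - k t) ^ 2 ≤ (k2 - k t) * min (dm - s) (w * (k2 - k t)) := by
        rcases le_total 0 (k2 - k t) with hD | hD
        · have hle : c * (k2 - k t) ≤ min (dm - s) (w * (k2 - k t)) :=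
            le_min (by nlinarith [hge t ht]) (by nlinarith)
          nlinarith
        · rw [min_eq_right (by nlinarith)]
          nlinarith [sq_nonneg (k2 - k t)]
      rw [hd]
      calc (k2 - k t) * -(min (dm - s) (w * (k2 - k t)) / l0)
          = -((k2 - k t) * min (dm - s) (w * (k2 - k t)) / l0) := by ring
        _ ≤ -(c * (k2 - k t) ^ 2 / l0) := by gcongr
        _ = -(c / l0) * (k2 - k t) ^ 2 := by ring
  simpa using hlim.const_sub k2
end

section
/- For the closed-loop PI-controlled link queue system l0*k'(t) = F(u(t), k(t)) − G(k(t)), u'(t) = −α*k'(t) + β*(k1 − k(t)) with gains α ≥ 0 and β > 0, and demand d⁻ > C, the integral term removes the congested equilibrium: a constant pair (k*, u*) with k* ∈ [0, k_j] and u* ∈ (0, v_f] is an equilibrium (i.e., F(u*, k*) = G(k*) and β*(k1 − k*) = 0) if and only if k* = k1 and u* = v1. In particular the unique equilibrium discharging flow-rate is the full capacity C. -/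
/-- For the closed-loop PI-controlled link queue system with gains `α ≥ 0`, `β > 0`
and demand `d⁻ > C`, the integral term removes the congested equilibrium: a constant
pair `(k*, u*)` with `k* ∈ [0, k_j]`, `u* ∈ (0, v_f]` satisfies the equilibrium
conditions `F(u*,k*) = G(k*)` and `β*(k1 − k*) = 0` iff `k* = k1` and `u* = v1`;
the unique equilibrium discharging flow-rate is the full capacity `C`. -/
theorem PI_controller_removes_congested_equilibrium
    (vf w kj C Δ dm l0 α β : ℝ)
    (hvf : 0 < vf) (hw : 0 < w) (hkj : 0 < kj)
    (hC0 : 0 < C) (hCub : C < vf * w * kj / (vf + w))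
    (hΔ0 : 0 < Δ) (hΔ1 : Δ < 1)
    (hl0 : 0 < l0) (hα : 0 ≤ α) (hβ : 0 < β) (hdm : C < dm) :
    (∀ ks us : ℝ, 0 ≤ ks → ks ≤ kj → 0 < us → us ≤ vf →
      ((influx dm w kj us ks = outflux vf C Δ ks ∧ β * (C / vf - ks) = 0) ↔
        (ks = C / vf ∧ us = C * w / (kj * w - C)))) ∧
    outflux vf C Δ (C / vf) = C := by
  have hout : outflux vf C Δ (C / vf) = C := by
    rw [outflux, if_pos le_rfl, mul_div_cancel₀ _ hvf.ne']
  have hub : C * (vf + w) < vf * w * kj := (lt_div_iff₀ (by positivity)).mp hCub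
  have hgap : 0 < kj * w - C := by
    by_contra! h
    nlinarith [mul_nonneg hvf.le (sub_nonneg.mpr (sub_nonpos.mp h)), mul_pos hC0 hw]
  have hsupply : C < w * (kj - C / vf) := by
    have h : w * (kj - C / vf) = (w * kj * vf - w * C) / vf := by field_simp
    rw [h, lt_div_iff₀ hvf]
    linarith
  refine ⟨fun ks us _ _ hus _ => ?_, hout⟩
  have hflow : us * w * kj / (us + w) = C ↔ us = C * w / (kj * w - C) := by
    rw [div_eq_iff (by positivity), eq_div_iff hgap.ne']
    constructor <;> intro h <;> linarith
  constructor
  · rintro ⟨hF, hint⟩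
    have hks : ks = C / vf := by
      linarith [(mul_eq_zero.mp hint).resolve_left hβ.ne']
    subst hks
    refine ⟨rfl, hflow.mp ?_⟩
    rw [hout, influx] at hF
    rcases min_choice dm (min (us * w * kj / (us + w)) (w * (kj - C / vf))) with h | h
    · linarith
    · rcases min_choice (us * w * kj / (us + w)) (w * (kj - C / vf)) with h' | h' <;> linarith
  · rintro ⟨rfl, hu⟩
    refine ⟨?_, by simp⟩
    rw [hout, influx, hflow.mpr hu, min_eq_left hsupply.le, min_eq_right hdm.le]
end

section
/- For the proportional-only controller u(k) = v1 + α*(k1 − k) (i.e., β = 0) with gain α ≥ (v1 − v2)/(k2 − k1) and demand d⁻ ≥ C, the density k* = k1 + (v1 − v2)/α is a congested equilibrium of the closed-loop link queue system: it satisfies k1 < k* ≤ k2, u(k*) = v2, F(v2, k*) = G(k*), and the equilibrium discharging flow-rate is the dropped capacity (1−Δ)C. -/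
/-- For the proportional-only controller `u(k) = v1 + α*(k1 − k)` with gain
`α ≥ (v1 − v2)/(k2 − k1)` and demand `d⁻ ≥ C`, the density
`k* = k1 + (v1 − v2)/α` is a congested equilibrium of the closed-loop system:
`k1 < k* ≤ k2`, `u(k*) = v2`, `F(v2, k*) = G(k*)`, and the equilibrium
discharging flow-rate is the dropped capacity `(1−Δ)C`. -/
theorem P_controller_large_gain_congested_equilibrium
    (vf w kj C Δ dm α : ℝ)
    (hvf : 0 < vf) (hw : 0 < w) (hkj : 0 < kj)
    (hC0 : 0 < C) (hCub : C < vf * w * kj / (vf + w))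
    (hΔ0 : 0 < Δ) (hΔ1 : Δ < 1)
    (hdm : C ≤ dm)
    (hα : (C * w / (kj * w - C) - (1 - Δ) * C * w / (kj * w - (1 - Δ) * C)) /
        ((kj - (1 - Δ) * C / w) - C / vf) ≤ α) :
    C / vf < C / vf + (C * w / (kj * w - C) - (1 - Δ) * C * w / (kj * w - (1 - Δ) * C)) / α ∧
    C / vf + (C * w / (kj * w - C) - (1 - Δ) * C * w / (kj * w - (1 - Δ) * C)) / α
      ≤ kj - (1 - Δ) * C / w ∧
    C * w / (kj * w - C) +
        α * (C / vf -
          (C / vf + (C * w / (kj * w - C) - (1 - Δ) * C * w / (kj * w - (1 - Δ) * C)) / α))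
      = (1 - Δ) * C * w / (kj * w - (1 - Δ) * C) ∧
    influx dm w kj ((1 - Δ) * C * w / (kj * w - (1 - Δ) * C))
        (C / vf + (C * w / (kj * w - C) - (1 - Δ) * C * w / (kj * w - (1 - Δ) * C)) / α)
      = outflux vf C Δ
        (C / vf + (C * w / (kj * w - C) - (1 - Δ) * C * w / (kj * w - (1 - Δ) * C)) / α) ∧
    outflux vf C Δ
        (C / vf + (C * w / (kj * w - C) - (1 - Δ) * C * w / (kj * w - (1 - Δ) * C)) / α)
      = (1 - Δ) * C := by
  unfold influx outflux
  have hCmul : C * (vf + w) < vf * w * kj := (lt_div_iff₀ (by positivity)).mp hCub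
  have hq0 : 0 < (1 - Δ) * C := mul_pos (by linarith) hC0
  have hqC : (1 - Δ) * C < C := by nlinarith
  generalize (1 - Δ) * C = q at *
  have hCden : 0 < kj * w - C := by
    have : 0 < vf * (kj * w - C) := by nlinarith [mul_pos hC0 hw]
    exact pos_of_mul_pos_right this hvf.le
  have hqden : 0 < kj * w - q := by linarith
  have hv : q * w / (kj * w - q) < C * w / (kj * w - C) := by
    rw [div_lt_div_iff₀ hqden hCden]
    nlinarith [mul_pos (mul_pos hkj (mul_pos hw hw)) (sub_pos.mpr hqC)]
  have hk : C / vf < kj - q / w := by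
    have hqw : q / w < C / w := by gcongr
    have hsum : C / vf + C / w < kj := by
      rw [div_add_div _ _ hvf.ne' hw.ne', div_lt_iff₀ (by positivity)]
      nlinarith
    linarith
  have hflow : q * w / (kj * w - q) * w * kj / (q * w / (kj * w - q) + w) = q := by
    have hne := hqden.ne'
    have hadd : q * w / (kj * w - q) + w = w * kj * w / (kj * w - q) := by
      rw [div_add' _ _ _ hne]
      ring
    rw [hadd, div_mul_eq_mul_div, div_mul_eq_mul_div, div_div_div_cancel_right₀ hne,
      div_eq_iff (by positivity)]
    ring
  rw [hflow]
  generalize q * w / (kj * w - q) = v₂ at *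
  generalize C * w / (kj * w - C) = v₁ at *
  have hα0 : 0 < α := (div_pos (sub_pos.mpr hv) (sub_pos.mpr hk)).trans_le hα
  have hgap : 0 < (v₁ - v₂) / α := div_pos (sub_pos.mpr hv) hα0
  have hle : C / vf + (v₁ - v₂) / α ≤ kj - q / w := by
    have := (div_le_comm₀ (sub_pos.mpr hk) hα0).mp hα
    linarith
  have hnot : ¬ C / vf + (v₁ - v₂) / α ≤ C / vf := by linarith
  have hsupply : q ≤ w * (kj - (C / vf + (v₁ - v₂) / α)) := by
    have : q / w ≤ kj - (C / vf + (v₁ - v₂) / α) := by linarith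
    rwa [div_le_iff₀' hw] at this
  refine ⟨by linarith, hle, ?_, ?_, if_neg hnot⟩
  · field_simp
    ring
  · rw [if_neg hnot, min_eq_left hsupply, min_eq_right (by linarith)]
end

section
/- For the proportional-only controller u(k) = v1 + α*(k1 − k) (i.e., β = 0) with gain 0 < α ≤ (v1 − v2)/(k2 − k1) and demand d⁻ ≥ C, the density k* = k2 is a congested equilibrium of the closed-loop link queue system: the feedback speed limit satisfies u(k2) = v1 − α*(k2 − k1) with v2 ≤ u(k2) < v1, F(u(k2), k2) = G(k2), and the equilibrium discharging flow-rate is the dropped capacity (1−Δ)C. -/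
/-- For the proportional-only controller `u(k) = v1 + α*(k1 − k)` with gain
`0 < α ≤ (v1 − v2)/(k2 − k1)` and demand `d⁻ ≥ C`, the density `k* = k2` is a
congested equilibrium of the closed-loop system: the feedback speed limit is
`u(k2) = v1 − α*(k2 − k1)`, satisfies `v2 ≤ u(k2) < v1`, `F(u(k2), k2) = G(k2)`,
and the equilibrium discharging flow-rate is the dropped capacity `(1−Δ)C`. -/
theorem P_controller_small_gain_congested_equilibrium
    (vf w kj C Δ dm α : ℝ)
    (hvf : 0 < vf) (hw : 0 < w) (hkj : 0 < kj)
    (hC0 : 0 < C) (hCub : C < vf * w * kj / (vf + w))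
    (hΔ0 : 0 < Δ) (hΔ1 : Δ < 1)
    (hdm : C ≤ dm)
    (hα0 : 0 < α)
    (hα : α ≤ (C * w / (kj * w - C) - (1 - Δ) * C * w / (kj * w - (1 - Δ) * C)) /
        ((kj - (1 - Δ) * C / w) - C / vf)) :
    C * w / (kj * w - C) + α * (C / vf - (kj - (1 - Δ) * C / w))
      = C * w / (kj * w - C) - α * ((kj - (1 - Δ) * C / w) - C / vf) ∧
    (1 - Δ) * C * w / (kj * w - (1 - Δ) * C)
      ≤ C * w / (kj * w - C) - α * ((kj - (1 - Δ) * C / w) - C / vf) ∧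
    C * w / (kj * w - C) - α * ((kj - (1 - Δ) * C / w) - C / vf) < C * w / (kj * w - C) ∧
    influx dm w kj (C * w / (kj * w - C) - α * ((kj - (1 - Δ) * C / w) - C / vf))
        (kj - (1 - Δ) * C / w)
      = outflux vf C Δ (kj - (1 - Δ) * C / w) ∧
    outflux vf C Δ (kj - (1 - Δ) * C / w) = (1 - Δ) * C := by
  have hden : 0 < vf + w := by positivity
  have hcap : C * (vf + w) < vf * w * kj := (lt_div_iff₀ hden).1 hCub
  have hCkj : C < kj * w := by
    by_contra! h
    nlinarith [mul_le_mul_of_nonneg_left h hvf.le, mul_pos hC0 hw]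
  obtain ⟨D, hD⟩ : ∃ D, D = (1 - Δ) * C := ⟨_, rfl⟩
  have hD0 : 0 < D := hD ▸ mul_pos (by linarith) hC0
  have hDC : D < C := by nlinarith
  rw [← hD] at hα ⊢
  have hgap : 0 < kj - D / w - C / vf := by
    have h : kj - D / w - C / vf = (vf * w * kj - D * vf - C * w) / (vf * w) := by
      field_simp
    rw [h]
    apply div_pos _ (by positivity)
    nlinarith [mul_lt_mul_of_pos_right hDC hvf]
  have hαgap := (le_div_iff₀ hgap).1 hα
  have hout : outflux vf C Δ (kj - D / w) = D := by
    rw [outflux, if_neg (by linarith), hD]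
  have hv2 : 0 < D * w / (kj * w - D) := div_pos (by positivity) (by linarith)
  have hle : D * w / (kj * w - D)
      ≤ C * w / (kj * w - C) - α * (kj - D / w - C / vf) := by linarith
  refine ⟨by ring, hle, by linarith [mul_pos hα0 hgap], ?_, hout⟩
  rw [hout]
  generalize C * w / (kj * w - C) - α * (kj - D / w - C / vf) = u at hle ⊢
  have hu : 0 < u := hv2.trans_le hle
  have hsupply : w * (kj - (kj - D / w)) = D := by field_simp; ring
  have hlimit : D ≤ u * w * kj / (u + w) := by
    rw [le_div_iff₀ (by positivity)]
    rw [div_le_iff₀ (by linarith)] at hle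
    linarith
  rw [influx, hsupply, min_eq_right hlimit, min_eq_right (by linarith)]
end

section
/- If there is no capacity drop (Δ = 0), variable speed limits cannot increase the equilibrium discharging flow-rate: with out-flux function G0(k) = min{v_f*k, C}, for every speed limit u ∈ (0, v_f] there exists an equilibrium density k* ∈ [0, k_j] with F(u, k*) = G0(k*), every such equilibrium has the same flow G0(k*) = min{d⁻, u*w*k_j/(u+w), C}, and this equilibrium flow equals the optimal value min{d⁻, C} if and only if u*w*k_j/(u+w) ≥ min{d⁻, C}. In particular, since v_f*w*k_j/(v_f+w) > C, the optimal flow is achieved without any VSL control (u = v_f). -/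
/-- Out-flux without capacity drop (`Δ = 0`): `G0(k) = min{v_f*k, C}`. -/
noncomputable def outflux0 (vf C k : ℝ) : ℝ :=
  min (vf * k) C

/-- At an equilibrium whose congested branch `w * (kj - k)` and free-flow branch `vf * k` cross
strictly above the capacity `C`, the flow is the smallest of demand, supply cap and capacity. -/
theorem equilibrium_flow_eq {vf w kj C dm A k : ℝ} (hvf : 0 < vf) (hw : 0 < w)
    (hC : C * (vf + w) < vf * w * kj)
    (h : min dm (min A (w * (kj - k))) = min (vf * k) C) :
    min (vf * k) C = min dm (min A C) := by
  apply le_antisymm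
  · refine le_min (h ▸ min_le_left _ _) (le_min ?_ (min_le_right _ _))
    exact h ▸ (min_le_right _ _).trans (min_le_left _ _)
  · by_contra! hlt
    obtain ⟨hdm, hA, hCk⟩ : min (vf * k) C < dm ∧ min (vf * k) C < A ∧ min (vf * k) C < C := by
      simpa only [lt_min_iff] using hlt
    have hfree : vf * k < C := by
      by_contra! hle
      exact hCk.ne (min_eq_right hle)
    rw [min_eq_left hfree.le] at h hdm hA
    have hcong : w * (kj - k) ≤ vf * k := by
      by_contra! hgt
      exact (lt_min hdm (lt_min hA hgt)).ne' h
    nlinarith [mul_le_mul_of_nonneg_left hcong hvf.le,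
      mul_lt_mul_of_pos_right hfree (add_pos hvf hw)]

/-- An equilibrium density exists when the free-flow and congested branches cross strictly above
the capacity `C`. -/
theorem exists_equilibrium {vf w kj C dm A : ℝ} (hvf : 0 < vf) (hw : 0 < w) (hC0 : 0 < C)
    (hC : C * (vf + w) < vf * w * kj) (hdm : 0 < dm) (hA : 0 < A) :
    ∃ k : ℝ, 0 ≤ k ∧ k ≤ kj ∧ min dm (min A (w * (kj - k))) = min (vf * k) C := by
  rcases le_total (min dm A) C with hm | hm
  · set m := min dm A with hm_def
    have hm0 : 0 < m := lt_min hdm hA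
    have hvk : vf * (m / vf) = m := mul_div_cancel₀ m hvf.ne'
    have hle : m ≤ w * (kj - m / vf) := by
      refine le_of_mul_le_mul_left ?_ hvf
      have hexp : vf * (w * (kj - m / vf)) = vf * w * kj - w * (vf * (m / vf)) := by ring
      rw [hexp, hvk]
      nlinarith [mul_le_mul_of_nonneg_right hm (add_pos hvf hw).le]
    refine ⟨m / vf, by positivity, ?_, ?_⟩
    · linarith [pos_of_mul_pos_right (hm0.trans_le hle) hw.le]
    · rw [← min_assoc, ← hm_def, hvk, min_eq_left hle, min_eq_left hm]
  · have hwk : w * (C / w) = C := mul_div_cancel₀ C hw.ne'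
    have hle : C ≤ vf * (kj - C / w) := by
      refine le_of_mul_le_mul_left ?_ hw
      have hexp : w * (vf * (kj - C / w)) = vf * w * kj - vf * (w * (C / w)) := by ring
      rw [hexp, hwk]
      linarith
    refine ⟨kj - C / w, (pos_of_mul_pos_right (hC0.trans_le hle) hvf.le).le, ?_, ?_⟩
    · linarith [div_pos hC0 hw]
    · rw [← min_assoc, sub_sub_cancel, hwk, min_eq_right hm, min_eq_right hle]

/-- A bound `b` does not lower `min a c` exactly when it is at least `min a c`. -/
theorem min_min_eq_min_iff {α : Type*} [LinearOrder α] {a b c : α} :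
    min a (min b c) = min a c ↔ min a c ≤ b := by
  rw [min_left_comm, min_eq_right_iff]

/-- If there is no capacity drop (`Δ = 0`), variable speed limits cannot increase the
equilibrium discharging flow-rate: for every speed limit `u ∈ (0, v_f]` an equilibrium
exists, every equilibrium has flow `min{d⁻, u*w*k_j/(u+w), C}`, and this flow equals
the optimal `min{d⁻, C}` iff `u*w*k_j/(u+w) ≥ min{d⁻, C}`; in particular the optimal
flow is achieved without control (`u = v_f`). -/
theorem no_capacity_drop_VSL_useless
    (vf w kj C dm : ℝ)
    (hvf : 0 < vf) (hw : 0 < w) (hkj : 0 < kj)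
    (hC0 : 0 < C) (hCub : C < vf * w * kj / (vf + w))
    (hdm : 0 < dm) :
    (∀ u : ℝ, 0 < u → u ≤ vf →
      (∃ ks : ℝ, 0 ≤ ks ∧ ks ≤ kj ∧ influx dm w kj u ks = outflux0 vf C ks) ∧
      (∀ ks : ℝ, 0 ≤ ks → ks ≤ kj → influx dm w kj u ks = outflux0 vf C ks →
        outflux0 vf C ks = min dm (min (u * w * kj / (u + w)) C)) ∧
      (min dm (min (u * w * kj / (u + w)) C) = min dm C ↔
        min dm C ≤ u * w * kj / (u + w))) ∧
    (∀ ks : ℝ, 0 ≤ ks → ks ≤ kj → influx dm w kj vf ks = outflux0 vf C ks →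
      outflux0 vf C ks = min dm C) := by
  have hC : C * (vf + w) < vf * w * kj := (lt_div_iff₀ (add_pos hvf hw)).mp hCub
  refine ⟨fun u hu _ => ⟨?_, ?_, min_min_eq_min_iff⟩, ?_⟩
  · exact exists_equilibrium hvf hw hC0 hC hdm (by positivity)
  · exact fun ks _ _ h => equilibrium_flow_eq hvf hw hC h
  · intro ks _ _ h
    exact (equilibrium_flow_eq hvf hw hC h).trans
      (min_min_eq_min_iff.mpr ((min_le_right _ _).trans hCub.le))
end
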